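/- Let U and V be two plane domains (nonempty open connected subsets of ℝ²) with smooth boundaries, and let f: ∂U → ∂V be a bijective mapping that is a local isometry of the boundaries of these domains in their relative metrics. Then f is a global isometry between ∂U and ∂V with respect to their intrinsic metrics (where the intrinsic metric of the curve ∂U is the infimum of lengths of paths joining two given points inside ∂U). -/

import Mathlib

open Set Filter Metric Topology ENNReal

noncomputable section

/-- A domain in `ℝⁿ`: a nonempty open connected set. -/
def IsDomainSet {n : ℕ} (U : Set (EuclideanSpace ℝ (Fin n))) : Prop :=
  IsOpen U ∧ IsConnected U

/-- The infimum of lengths of smooth paths joining `a` and `b` inside `U`. -/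
def smoothPathInf {n : ℕ} (U : Set (EuclideanSpace ℝ (Fin n)))
    (a b : EuclideanSpace ℝ (Fin n)) : ℝ≥0∞ :=
  ⨅ (γ : ℝ → EuclideanSpace ℝ (Fin n)) (_ : ContDiff ℝ 1 γ) (_ : γ 0 = a)
    (_ : γ 1 = b) (_ : ∀ t ∈ Icc (0:ℝ) 1, γ t ∈ U), eVariationOn γ (Icc 0 1)

/-- The relative metric `ρ_{∂U,U}`:
`ρ(x,y) = liminf_{x'→x, y'→y; x',y'∈U} inf{length γ : γ smooth path joining x',y' in U}`. -/
def relDist {n : ℕ} (U : Set (EuclideanSpace ℝ (Fin n)))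
    (x y : EuclideanSpace ℝ (Fin n)) : ℝ≥0∞ :=
  Filter.liminf (fun p : EuclideanSpace ℝ (Fin n) × EuclideanSpace ℝ (Fin n) =>
    smoothPathInf U p.1 p.2) ((𝓝[U] x) ×ˢ (𝓝[U] y))

/-- `f` is a bijection of `∂U` onto `∂V` which is a local isometry
in the relative metrics of the boundaries. -/
def IsBoundaryLocalIsometry {n : ℕ} (U V : Set (EuclideanSpace ℝ (Fin n)))
    (f : EuclideanSpace ℝ (Fin n) → EuclideanSpace ℝ (Fin n)) : Prop :=
  Set.BijOn f (frontier U) (frontier V) ∧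
  ∀ y ∈ frontier U, ∃ ε : ℝ≥0∞, 0 < ε ∧ ∀ a ∈ frontier U, ∀ b ∈ frontier U,
    relDist U a y < ε → relDist U b y < ε →
      relDist U a b = relDist V (f a) (f b)

/-- `U` has smooth boundary: `∂U` is an `(n-1)`-dimensional submanifold of
class `C¹` without boundary, i.e. near each of its points the frontier can be
mapped by a `C¹` diffeomorphism onto an open piece of a hyperplane. -/
def HasC1Boundary {n : ℕ} (U : Set (EuclideanSpace ℝ (Fin n))) : Prop :=
  ∀ x ∈ frontier U, ∃ (W W' : Set (EuclideanSpace ℝ (Fin n)))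
    (φ ψ : EuclideanSpace ℝ (Fin n) → EuclideanSpace ℝ (Fin n))
    (ℓ : EuclideanSpace ℝ (Fin n) →L[ℝ] ℝ),
    IsOpen W ∧ x ∈ W ∧ IsOpen W' ∧ ℓ ≠ 0 ∧
    ContDiffOn ℝ 1 φ W ∧ ContDiffOn ℝ 1 ψ W' ∧
    Set.MapsTo φ W W' ∧ Set.MapsTo ψ W' W ∧
    (∀ z ∈ W, ψ (φ z) = z) ∧ (∀ z ∈ W', φ (ψ z) = z) ∧
    φ '' (W ∩ frontier U) = W' ∩ {y | ℓ y = 0}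

/-- The intrinsic distance inside a set `S`: the infimum of lengths of
(continuous) paths joining `a` and `b` inside `S`. -/
def intrinsicDist {n : ℕ} (S : Set (EuclideanSpace ℝ (Fin n)))
    (a b : EuclideanSpace ℝ (Fin n)) : ℝ≥0∞ :=
  ⨅ (γ : ℝ → EuclideanSpace ℝ (Fin n)) (_ : ContinuousOn γ (Icc (0:ℝ) 1))
    (_ : γ 0 = a) (_ : γ 1 = b) (_ : ∀ t ∈ Icc (0:ℝ) 1, γ t ∈ S),
    eVariationOn γ (Icc 0 1)

lemma edist_le_relDist {n : ℕ} (U : Set (EuclideanSpace ℝ (Fin n)))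
    (a b : EuclideanSpace ℝ (Fin n)) : edist a b ≤ relDist U a b := by
  refine le_of_forall_lt fun c hc => ?_
  obtain ⟨d, hcd, hd⟩ := exists_between hc
  refine hcd.trans_le (le_liminf_of_le (h := ?_))
  have h1 : ∀ᶠ p in 𝓝 a ×ˢ 𝓝 b, d < edist p.1 p.2 := by
    rw [← nhds_prod_eq]
    exact (continuous_edist.tendsto (a, b)).eventually (lt_mem_nhds hd)
  have h2 : (𝓝[U] a) ×ˢ (𝓝[U] b) ≤ 𝓝 a ×ˢ 𝓝 b :=
    Filter.prod_mono nhdsWithin_le_nhds nhdsWithin_le_nhds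
  filter_upwards [h2 h1] with p hp
  refine hp.le.trans ?_
  refine le_iInf fun γ => le_iInf fun _ => le_iInf fun h0 => le_iInf fun h1 => le_iInf fun _ => ?_
  rw [← h0, ← h1]
  exact eVariationOn.edist_le γ (by simp) (by simp)

/-- Near a boundary point, one of the two sides of the boundary lies in the domain. -/
lemma exists_side {n : ℕ} {U : Set (EuclideanSpace ℝ (Fin n))} (hU : IsOpen U)
    {W' : Set (EuclideanSpace ℝ (Fin n))} {ψ : EuclideanSpace ℝ (Fin n) → EuclideanSpace ℝ (Fin n)}
    {ℓ : EuclideanSpace ℝ (Fin n) →L[ℝ] ℝ} {p : EuclideanSpace ℝ (Fin n)} {r : ℝ}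
    (hℓ : ℓ ≠ 0) (hr : ball p r ⊆ W') (hψ : ContinuousOn ψ W')
    (hfr : ∀ q ∈ ball p r, ψ q ∈ frontier U ↔ ℓ q = 0)
    (hne : ∃ q ∈ ball p r, ψ q ∈ U) :
    ∃ m : EuclideanSpace ℝ (Fin n) →L[ℝ] ℝ, m ≠ 0 ∧ (∀ q, m q = 0 ↔ ℓ q = 0) ∧
      ∀ q ∈ ball p r, 0 < m q → ψ q ∈ U := by
  have key : ∀ m : EuclideanSpace ℝ (Fin n) →L[ℝ] ℝ, (∀ q, m q = 0 ↔ ℓ q = 0) →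
      (∃ q ∈ ball p r, ψ q ∈ U ∧ 0 < m q) → ∀ q ∈ ball p r, 0 < m q → ψ q ∈ U := by
    intro m hm ⟨q₀, hq₀, hq₀U, hmq₀⟩ q hq hmq
    have hconv : Convex ℝ (ball p r ∩ {q | 0 < m q}) :=
      (convex_ball p r).inter (convex_halfSpace_gt m.toLinearMap.isLinear 0)
    have hpre : IsPreconnected (ψ '' (ball p r ∩ {q | 0 < m q})) :=
      hconv.isPreconnected.image _ (hψ.mono (inter_subset_left.trans hr))
    by_contra hcon
    rcases isPreconnected_iff_subset_of_disjoint.1 hpre U (closure U)ᶜ hU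
      isClosed_closure.isOpen_compl
      (by
        rintro _ ⟨q', ⟨hq', hmq'⟩, rfl⟩
        by_contra hnot
        simp only [mem_union, mem_compl_iff, not_or, not_not] at hnot
        have : ψ q' ∈ frontier U := by
          rw [hU.frontier_eq]; exact ⟨hnot.2, hnot.1⟩
        exact (show 0 < m q' from hmq').ne' ((hm q').2 ((hfr q' hq').1 this)))
      (by
        ext x
        simp only [mem_inter_iff, mem_compl_iff, mem_empty_iff_false, iff_false]
        rintro ⟨_, h1, h2⟩
        exact h2 (subset_closure h1)) with h | h
    · exact hcon (h ⟨q, ⟨hq, hmq⟩, rfl⟩)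
    · exact h ⟨q₀, ⟨hq₀, hmq₀⟩, rfl⟩ (subset_closure hq₀U)
  obtain ⟨q₀, hq₀, hq₀U⟩ := hne
  have h0 : ℓ q₀ ≠ 0 := fun h => by
    have := (hfr q₀ hq₀).2 h
    rw [hU.frontier_eq] at this
    exact this.2 hq₀U
  rcases lt_or_gt_of_ne h0 with h | h
  · refine ⟨-ℓ, by simpa using hℓ, by simp, key _ (by simp) ⟨q₀, hq₀, hq₀U, by simpa using h⟩⟩
  · exact ⟨ℓ, hℓ, by simp, key _ (by simp) ⟨q₀, hq₀, hq₀U, h⟩⟩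

/-- A `C`-Lipschitz path of class `C¹` over `[0, 1]` inside `U` bounds the infimum of lengths of
smooth paths in `U` between its endpoints by `C`; `F` may be arbitrary outside `[0, 1]`. -/
lemma smoothPathInf_le_of_segment {n : ℕ} {U : Set (EuclideanSpace ℝ (Fin n))}
    {F : ℝ → EuclideanSpace ℝ (Fin n)} {C : NNReal} (hF : ∀ t ∈ Icc (0:ℝ) 1, ContDiffAt ℝ 1 F t)
    (hL : LipschitzOnWith C F (Icc 0 1)) (hFU : ∀ t ∈ Icc (0:ℝ) 1, F t ∈ U) :
    smoothPathInf U (F 0) (F 1) ≤ C := by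
  have hmem : ∀ t, Real.smoothTransition t ∈ Icc (0:ℝ) 1 := fun t =>
    ⟨Real.smoothTransition.nonneg t, Real.smoothTransition.le_one t⟩
  have hle : smoothPathInf U (F 0) (F 1) ≤
      eVariationOn (F ∘ Real.smoothTransition) (Icc 0 1) := by
    refine iInf_le_of_le _ <| iInf_le_of_le ?_ <| iInf_le_of_le (by simp) <|
      iInf_le_of_le (by simp) <| iInf_le_of_le (fun t _ => hFU _ (hmem t)) le_rfl
    exact contDiff_iff_contDiffAt.2 fun t =>
      (hF _ (hmem t)).comp t Real.smoothTransition.contDiffAt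
  refine hle.trans ((hL.comp_eVariationOn_le fun t _ => hmem t).trans ?_)
  have := (Real.smoothTransition.monotone.monotoneOn (Icc 0 1)).eVariationOn_eq
    (a := 0) (b := 1) (by simp) (by simp)
  rw [inter_self] at this
  calc _ ≤ (C : ℝ≥0∞) * 1 := by gcongr; simp [this]
    _ = C := mul_one _

/-- The relative metric is locally almost Euclidean near each point of a `C¹` boundary. -/
lemma exists_relDist_le {n : ℕ} {U : Set (EuclideanSpace ℝ (Fin n))} (hU : IsOpen U)
    (hUb : HasC1Boundary U) {y : EuclideanSpace ℝ (Fin n)} (hy : y ∈ frontier U)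
    {K : NNReal} (hK : 1 < K) :
    ∃ δ > 0, ∀ a ∈ frontier U ∩ ball y δ, ∀ b ∈ frontier U ∩ ball y δ,
      relDist U a b ≤ K * edist a b := by
  obtain ⟨W, W', φ, ψ, ℓ, hW, hyW, hW', hℓ, hφ, hψ, hφW, hψW, hψφ, hφψ, himg⟩ := hUb y hy
  have hφy : φ y ∈ W' := hφW hyW
  have hφc : ContDiffAt ℝ 1 φ y := hφ.contDiffAt (hW.mem_nhds hyW)
  have hψc : ContDiffAt ℝ 1 ψ (φ y) := hψ.contDiffAt (hW'.mem_nhds hφy)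
  obtain ⟨L, t, ht, hLt⟩ := hφc.exists_lipschitzOnWith
  set κ : NNReal := (K - 1) / (2 * (L + 1)) with hκ
  have hκ0 : 0 < κ := div_pos (tsub_pos_of_lt hK) (by positivity)
  obtain ⟨s, hs, hA⟩ :=
    (hψc.hasStrictFDerivAt one_ne_zero).approximates_deriv_on_nhds (c := κ) (Or.inr hκ0)
  set A := fderiv ℝ ψ (φ y)
  obtain ⟨r, hr0, hr⟩ := Metric.mem_nhds_iff.1 (inter_mem (hW'.mem_nhds hφy) hs)
  have hfrW : ∀ a ∈ W, a ∈ frontier U → ℓ (φ a) = 0 := fun a ha haU =>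
    (himg.subset ⟨a, ⟨ha, haU⟩, rfl⟩).2
  have hfr : ∀ q ∈ ball (φ y) r, ψ q ∈ frontier U ↔ ℓ q = 0 := by
    intro q hq
    have hqW := (hr hq).1
    constructor
    · intro h
      simpa [hφψ q hqW] using hfrW _ (hψW hqW) h
    · intro h
      obtain ⟨a, ⟨ha, haU⟩, rfl⟩ := himg.superset ⟨hqW, h⟩
      rwa [hψφ a ha]
  have hne : ∃ q ∈ ball (φ y) r, ψ q ∈ U := by
    have hnh : W ∩ φ ⁻¹' ball (φ y) r ∈ 𝓝 y :=
      inter_mem (hW.mem_nhds hyW) (hφc.continuousAt (ball_mem_nhds _ hr0))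
    obtain ⟨x, ⟨hxW, hx⟩, hxU⟩ := mem_closure_iff_nhds.1 (frontier_subset_closure hy) _ hnh
    exact ⟨φ x, hx, by rwa [hψφ x hxW]⟩
  obtain ⟨m, hm0, hmℓ, hmU⟩ := exists_side hU hℓ (fun q hq => (hr hq).1) hψ.continuousOn hfr hne
  obtain ⟨w, hw⟩ : ∃ w, 0 < m w := by
    obtain ⟨w, hw⟩ := DFunLike.ne_iff.1 hm0
    rcases lt_or_gt_of_ne hw with h | h
    · exact ⟨-w, by simpa using h⟩
    · exact ⟨w, by simpa using h⟩
  obtain ⟨δ, hδ0, hδ⟩ := Metric.mem_nhds_iff.1 (inter_mem (inter_mem ht (hW.mem_nhds hyW))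
    (hφc.continuousAt (ball_mem_nhds (φ y) (half_pos hr0))))
  refine ⟨δ, hδ0, ?_⟩
  rintro a ⟨haU, ha⟩ b ⟨hbU, hb⟩
  obtain ⟨⟨hat, haW⟩, har⟩ := hδ ha
  obtain ⟨⟨hbt, hbW⟩, hbr⟩ := hδ hb
  set u := φ b - φ a with hu
  have hball : ∀ σ : ℝ, ‖σ • w‖ < r / 2 → ∀ τ ∈ Icc (0:ℝ) 1,
      φ a + σ • w + τ • u ∈ ball (φ y) r := by
    intro σ hσ τ hτ
    have h1 : φ a + τ • u ∈ ball (φ y) (r / 2) :=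
      (convex_ball (φ y) (r / 2)).add_smul_sub_mem har hbr hτ
    rw [mem_ball_iff_norm] at h1 ⊢
    calc ‖φ a + σ • w + τ • u - φ y‖ = ‖(φ a + τ • u - φ y) + σ • w‖ := by congr 1; abel
      _ ≤ _ := norm_add_le _ _
      _ < r := by linarith
  have hmpos : ∀ σ : ℝ, 0 < σ → ∀ τ : ℝ, 0 < m (φ a + σ • w + τ • u) := by
    intro σ hσ τ
    have h1 : m (φ a) = 0 := (hmℓ _).2 (hfrW a haW haU)
    have h2 : m (φ b) = 0 := (hmℓ _).2 (hfrW b hbW hbU)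
    simp [hu, h1, h2]
    positivity
  set C : NNReal := ‖A u‖₊ + κ * ‖u‖₊ with hC
  have hseg : ∀ σ : ℝ, 0 < σ → ‖σ • w‖ < r / 2 →
      smoothPathInf U (ψ (φ a + σ • w)) (ψ (φ b + σ • w)) ≤ C := by
    intro σ hσ hσw
    have := smoothPathInf_le_of_segment (U := U) (C := C)
      (F := fun τ : ℝ => ψ (φ a + σ • w + τ • u)) ?_ ?_ ?_
    · rwa [zero_smul, add_zero,
        show φ a + σ • w + (1:ℝ) • u = φ b + σ • w by rw [hu]; module] at this
    · intro τ hτ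
      refine ContDiffAt.comp (g := ψ) τ (hψ.contDiffAt (hW'.mem_nhds (hr (hball σ hσw τ hτ)).1)) ?_
      fun_prop
    · refine LipschitzOnWith.of_dist_le_mul fun τ hτ τ' hτ' => ?_
      have h := hA _ (hr (hball σ hσw τ hτ)).2 _ (hr (hball σ hσw τ' hτ')).2
      have e : φ a + σ • w + τ • u - (φ a + σ • w + τ' • u) = (τ - τ') • u := by
        rw [sub_smul]; abel
      rw [e, map_smul, norm_smul] at h
      have h2 := norm_le_norm_sub_add (ψ (φ a + σ • w + τ • u) - ψ (φ a + σ • w + τ' • u))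
        ((τ - τ') • A u)
      rw [norm_smul] at h2
      rw [dist_eq_norm, dist_eq_norm, hC]
      push_cast
      linarith
    · exact fun τ hτ => hmU _ (hball σ hσw τ hτ) (hmpos σ hσ τ)
  have hCle : (C : ℝ≥0∞) ≤ K * edist a b := by
    have h1 := hA _ (hr (ball_subset_ball (half_le_self hr0.le) hbr)).2 _
      (hr (ball_subset_ball (half_le_self hr0.le) har)).2
    rw [hψφ a haW, hψφ b hbW, ← hu] at h1
    have h2 := norm_le_norm_sub_add (A u) (b - a)
    rw [norm_sub_rev] at h2
    have h3 : ‖u‖ ≤ L * ‖b - a‖ := by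
      simpa [dist_eq_norm] using hLt.dist_le_mul b hbt a hat
    have h4 : (κ : ℝ) * (2 * (L + 1)) = K - 1 := by
      have : κ * (2 * (L + 1)) = K - 1 := div_mul_cancel₀ _ (by positivity)
      rw [← NNReal.coe_one, ← NNReal.coe_sub hK.le, ← this]
      push_cast
      ring
    have h5 : (κ : ℝ) * ‖u‖ ≤ κ * (L * ‖b - a‖) := by gcongr
    have h6 : 0 ≤ (κ : ℝ) * ‖b - a‖ := by positivity
    have h7 : C ≤ K * nndist a b := by
      rw [← NNReal.coe_le_coe, hC]
      push_cast
      rw [dist_comm, dist_eq_norm]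
      have h8 : (K : ℝ) * ‖b - a‖ = ‖b - a‖ + κ * (2 * (L + 1)) * ‖b - a‖ := by rw [h4]; ring
      rw [h8]
      linarith
    rw [edist_nndist]
    exact_mod_cast h7
  refine le_trans ?_ hCle
  have hsmall : ∀ᶠ σ : ℝ in 𝓝[>] 0, 0 < σ ∧ ‖σ • w‖ < r / 2 := by
    refine (eventually_mem_nhdsWithin).and (nhdsWithin_le_nhds ?_)
    have : Continuous fun σ : ℝ => ‖σ • w‖ := by fun_prop
    exact (this.tendsto 0).eventually (gt_mem_nhds (by simpa using half_pos hr0))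
  have hlim : ∀ c ∈ W, (∀ᶠ σ : ℝ in 𝓝[>] 0, ψ (φ c + σ • w) ∈ U) →
      Tendsto (fun σ : ℝ => ψ (φ c + σ • w)) (𝓝[>] 0) (𝓝[U] c) := by
    intro c hc hcU
    refine tendsto_nhdsWithin_iff.2 ⟨tendsto_nhdsWithin_of_tendsto_nhds ?_, hcU⟩
    have h1 : ContinuousAt ψ (φ c + (0:ℝ) • w) := by
      simpa using hψ.continuousOn.continuousAt (hW'.mem_nhds (hφW hc))
    have h2 : ContinuousAt (fun σ : ℝ => ψ (φ c + σ • w)) 0 :=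
      ContinuousAt.comp (f := fun σ : ℝ => φ c + σ • w) h1 (by fun_prop)
    simpa [ContinuousAt, hψφ c hc] using h2
  have hla := hlim a haW (hsmall.mono fun σ hσ => by
    simpa using hmU _ (hball σ hσ.2 0 (by simp)) (hmpos σ hσ.1 0))
  have hlb := hlim b hbW (hsmall.mono fun σ hσ => by
    have := hmU _ (hball σ hσ.2 1 (by simp)) (hmpos σ hσ.1 1)
    rwa [show φ a + σ • w + (1:ℝ) • u = φ b + σ • w by rw [hu]; module] at this)
  refine liminf_le_of_frequently_le' (Tendsto.frequently (hla.prodMk hlb) ?_)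
  exact (hsmall.mono fun σ hσ => hseg σ hσ.1 hσ.2).frequently
/-- A local isometry of boundaries in the relative metrics preserves relative distances
on small Euclidean pieces of the boundary. -/
lemma IsBoundaryLocalIsometry.exists_relDist_eq {n : ℕ} {U V : Set (EuclideanSpace ℝ (Fin n))}
    {f : EuclideanSpace ℝ (Fin n) → EuclideanSpace ℝ (Fin n)}
    (hf : IsBoundaryLocalIsometry U V f) (hU : IsOpen U) (hUb : HasC1Boundary U)
    {y : EuclideanSpace ℝ (Fin n)} (hy : y ∈ frontier U) :
    ∃ δ > 0, ∀ a ∈ frontier U ∩ ball y δ, ∀ b ∈ frontier U ∩ ball y δ,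
      relDist U a b = relDist V (f a) (f b) := by
  obtain ⟨ε, hε, h⟩ := hf.2 y hy
  obtain ⟨δ, hδ0, hδ⟩ := exists_relDist_le hU hUb hy one_lt_two
  have hev : ∀ᶠ a in 𝓝 y, ((2 : NNReal) : ℝ≥0∞) * edist a y < ε := by
    have : Continuous fun a => ((2 : NNReal) : ℝ≥0∞) * edist a y :=
      ENNReal.continuous_const_mul coe_ne_top |>.comp (by fun_prop)
    exact (this.tendsto y).eventually (gt_mem_nhds (by simpa using hε))
  obtain ⟨δ', hδ'0, hδ'⟩ := Metric.eventually_nhds_iff_ball.1 hev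
  refine ⟨min δ δ', lt_min hδ0 hδ'0, ?_⟩
  have key : ∀ a ∈ frontier U ∩ ball y (min δ δ'), relDist U a y < ε := fun a ha =>
    (hδ a ⟨ha.1, ball_subset_ball (min_le_left _ _) ha.2⟩ y ⟨hy, mem_ball_self hδ0⟩).trans_lt
      (hδ' a (ball_subset_ball (min_le_right _ _) ha.2))
  exact fun a ha b hb => h a ha.1 b hb.1 (key a ha) (key b hb)

lemma IsBoundaryLocalIsometry.exists_lipschitzOnWith {n : ℕ}
    {U V : Set (EuclideanSpace ℝ (Fin n))} {f : EuclideanSpace ℝ (Fin n) → EuclideanSpace ℝ (Fin n)}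
    (hf : IsBoundaryLocalIsometry U V f) (hU : IsOpen U) (hUb : HasC1Boundary U)
    {K : NNReal} (hK : 1 < K) {y : EuclideanSpace ℝ (Fin n)} (hy : y ∈ frontier U) :
    ∃ δ > 0, LipschitzOnWith K f (frontier U ∩ ball y δ) := by
  obtain ⟨δ, hδ0, hδ⟩ := hf.exists_relDist_eq hU hUb hy
  obtain ⟨δ', hδ'0, hδ'⟩ := exists_relDist_le hU hUb hy hK
  refine ⟨min δ δ', lt_min hδ0 hδ'0, fun a ha b hb => ?_⟩
  have h1 : frontier U ∩ ball y (min δ δ') ⊆ frontier U ∩ ball y δ := by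
    gcongr; exact min_le_left _ _
  have h2 : frontier U ∩ ball y (min δ δ') ⊆ frontier U ∩ ball y δ' := by
    gcongr; exact min_le_right _ _
  calc edist (f a) (f b) ≤ relDist V (f a) (f b) := edist_le_relDist V _ _
    _ = relDist U a b := (hδ a (h1 ha) b (h1 hb)).symm
    _ ≤ K * edist a b := hδ' a (h2 ha) b (h2 hb)

/-- A nonzero functional on the plane has a kernel spanned by one vector, and the inner product
with that vector is a coordinate on the kernel. -/
lemma exists_ker_generator {ℓ : EuclideanSpace ℝ (Fin 2) →L[ℝ] ℝ} (hℓ : ℓ ≠ 0) :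
    ∃ v : EuclideanSpace ℝ (Fin 2), v ≠ 0 ∧ ℓ v = 0 ∧ ∀ x, ℓ x = 0 → inner ℝ v x = 0 → x = 0 := by
  have hrank : Module.finrank ℝ (LinearMap.ker ℓ.toLinearMap) = 1 := by
    have h := LinearMap.finrank_range_add_finrank_ker ℓ.toLinearMap
    have hr : LinearMap.range ℓ.toLinearMap = ⊤ :=
      LinearMap.range_eq_top.2 (LinearMap.surjective fun h => hℓ (by ext x; exact DFunLike.congr_fun h x))
    rw [hr, finrank_top] at h
    simp at h
    omega
  obtain ⟨v, hv0, hv⟩ := finrank_eq_one_iff'.1 hrank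
  refine ⟨v, by simpa using hv0, v.2, fun x hx hvx => ?_⟩
  obtain ⟨c, hc⟩ := hv ⟨x, hx⟩
  have hc' : c • (v : EuclideanSpace ℝ (Fin 2)) = x := congrArg Subtype.val hc
  rw [← hc', inner_smul_right, real_inner_self_eq_norm_sq] at hvx
  rw [← hc']
  rcases mul_eq_zero.1 hvx with h | h
  · simp [h]
  · exact absurd h (by simpa using hv0)

/-- Local parametrisation of a `C¹` boundary curve. -/
lemma HasC1Boundary.exists_param {U : Set (EuclideanSpace ℝ (Fin 2))} (hUb : HasC1Boundary U)
    {y : EuclideanSpace ℝ (Fin 2)} (hy : y ∈ frontier U) :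
    ∃ p : ℝ → EuclideanSpace ℝ (Fin 2), ∃ N ∈ 𝓝 (0:ℝ), p 0 = y ∧ ContinuousOn p N ∧ InjOn p N ∧
      MapsTo p N (frontier U) := by
  obtain ⟨W, W', φ, ψ, ℓ, hW, hyW, hW', hℓ, hφ, hψ, hφW, hψW, hψφ, hφψ, himg⟩ := hUb y hy
  obtain ⟨v, hv0, hv, -⟩ := exists_ker_generator hℓ
  have hcont : Continuous fun s : ℝ => φ y + s • v := by fun_prop
  have hy0 : ℓ (φ y) = 0 := (himg.subset ⟨y, ⟨hyW, hy⟩, rfl⟩).2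
  refine ⟨fun s => ψ (φ y + s • v), (fun s : ℝ => φ y + s • v) ⁻¹' W',
    hcont.continuousAt (hW'.mem_nhds (by simpa using hφW hyW)), by simp [hψφ y hyW],
    hψ.continuousOn.comp hcont.continuousOn fun s hs => hs, ?_, ?_⟩
  · intro s hs s' hs' h
    have h1 := congrArg φ h
    simp only [hφψ _ hs, hφψ _ hs'] at h1
    exact smul_left_injective ℝ hv0 (add_left_cancel h1)
  · intro s hs
    obtain ⟨a, ⟨ha, haU⟩, h⟩ := himg.superset ⟨hs, show ℓ (φ y + s • v) = 0 by simp [hy0, hv]⟩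
    change ψ (φ y + s • v) ∈ frontier U
    rwa [← show φ a = φ y + s • v from h, hψφ a ha]

/-- Local coordinate on a `C¹` boundary curve. -/
lemma HasC1Boundary.exists_coord {U : Set (EuclideanSpace ℝ (Fin 2))} (hUb : HasC1Boundary U)
    {y : EuclideanSpace ℝ (Fin 2)} (hy : y ∈ frontier U) :
    ∃ c : EuclideanSpace ℝ (Fin 2) → ℝ, ∃ N, IsOpen N ∧ y ∈ N ∧ ContinuousOn c N ∧
      InjOn c (N ∩ frontier U) := by
  obtain ⟨W, W', φ, ψ, ℓ, hW, hyW, hW', hℓ, hφ, hψ, hφW, hψW, hψφ, hφψ, himg⟩ := hUb y hy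
  obtain ⟨v, hv0, -, hv⟩ := exists_ker_generator hℓ
  refine ⟨fun x => inner ℝ v (φ x), W, hW, hyW, continuousOn_const.inner hφ.continuousOn, ?_⟩
  intro a ha b hb h
  have h0 : ∀ x ∈ W ∩ frontier U, ℓ (φ x) = 0 := fun x hx => (himg.subset ⟨x, hx, rfl⟩).2
  have := hv (φ a - φ b) (by simp [h0 a ha, h0 b hb]) (by rw [inner_sub_right]; exact sub_eq_zero.2 h)
  rw [← hψφ a ha.1, ← hψφ b hb.1, sub_eq_zero.1 this]

/-- A continuous injective real function near a point is open at that point. -/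
lemma image_Icc_mem_nhds {h : ℝ → ℝ} {τ : ℝ} (hτ : 0 < τ) (hc : ContinuousOn h (Icc (-τ) τ))
    (hi : InjOn h (Icc (-τ) τ)) : h '' Icc (-τ) τ ∈ 𝓝 (h 0) := by
  have hl : -τ ∈ Icc (-τ) τ := ⟨le_rfl, by linarith⟩
  have hr : τ ∈ Icc (-τ) τ := ⟨by linarith, le_rfl⟩
  have h0 : (0:ℝ) ∈ Icc (-τ) τ := ⟨by linarith, hτ.le⟩
  rcases hc.strictMonoOn_of_injOn_Icc' (by linarith) hi with hm | hm
  · exact mem_of_superset (Icc_mem_nhds (hm hl h0 (by linarith)) (hm h0 hr hτ))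
      (intermediate_value_Icc (by linarith) hc)
  · exact mem_of_superset (Icc_mem_nhds (hm h0 hr hτ) (hm hl h0 (by linarith)))
      (intermediate_value_Icc' (by linarith) hc)

/-- Invariance of domain for `C¹` boundary curves. -/
lemma exists_nhds_subset_image {U V : Set (EuclideanSpace ℝ (Fin 2))} (hUb : HasC1Boundary U)
    (hVb : HasC1Boundary V) {f : EuclideanSpace ℝ (Fin 2) → EuclideanSpace ℝ (Fin 2)}
    (hfc : ContinuousOn f (frontier U)) (hfm : MapsTo f (frontier U) (frontier V))
    (hfi : InjOn f (frontier U)) {y : EuclideanSpace ℝ (Fin 2)} (hy : y ∈ frontier U)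
    {O : Set (EuclideanSpace ℝ (Fin 2))} (hO : O ∈ 𝓝 y) :
    ∃ O' ∈ 𝓝 (f y), ∀ d ∈ frontier V ∩ O', ∃ a ∈ frontier U ∩ O, f a = d := by
  obtain ⟨p, M, hM, hp0, hpc, hpi, hpm⟩ := hUb.exists_param hy
  obtain ⟨c, N, hN, hyN, hcc, hci⟩ := hVb.exists_coord (hfm hy)
  have hfp : ContinuousOn (f ∘ p) M := hfc.comp hpc hpm
  have hev : ∀ᶠ s in 𝓝 (0:ℝ), s ∈ M ∧ p s ∈ O ∧ f (p s) ∈ N := by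
    have h1 : p ⁻¹' O ∈ 𝓝 0 := hpc.continuousAt hM (by rwa [hp0])
    have h2 : (f ∘ p) ⁻¹' N ∈ 𝓝 0 :=
      hfp.continuousAt hM (hN.mem_nhds (by simpa [hp0] using hyN))
    filter_upwards [hM, h1, h2] with s hs1 hs2 hs3 using ⟨hs1, hs2, hs3⟩
  obtain ⟨τ, hτ0, hτ⟩ := Metric.nhds_basis_closedBall.eventually_iff.1 hev
  rw [Real.closedBall_eq_Icc, zero_sub, zero_add] at hτ
  have himg := image_Icc_mem_nhds (h := c ∘ f ∘ p) hτ0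
    (hcc.comp (hfp.mono fun s hs => (hτ hs).1) fun s hs => (hτ hs).2.2)
    (by
      intro s hs s' hs' h
      obtain ⟨h1, h2, h3⟩ := hτ hs
      obtain ⟨h1', h2', h3'⟩ := hτ hs'
      exact hpi h1 h1' (hfi (hpm h1) (hpm h1') (hci ⟨h3, hfm (hpm h1)⟩ ⟨h3', hfm (hpm h1')⟩ h)))
  simp only [Function.comp_apply, hp0] at himg
  refine ⟨N ∩ c ⁻¹' _, inter_mem (hN.mem_nhds hyN)
    ((hcc.continuousAt (hN.mem_nhds hyN)) himg), ?_⟩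
  rintro d ⟨hdV, hdN, s, hs, hsd⟩
  obtain ⟨h1, h2, h3⟩ := hτ hs
  exact ⟨p s, ⟨hpm h1, h2⟩, hci ⟨h3, hfm (hpm h1)⟩ ⟨hdN, hdV⟩ hsd⟩

lemma continuousOn_of_locally_lipschitz {E F : Type*} [PseudoMetricSpace E]
    [PseudoMetricSpace F] {S : Set E} {f : E → F} {K : NNReal}
    (hf : ∀ y ∈ S, ∃ δ > 0, LipschitzOnWith K f (S ∩ ball y δ)) : ContinuousOn f S := by
  intro y hy
  obtain ⟨δ, hδ, h⟩ := hf y hy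
  exact (continuousWithinAt_inter (ball_mem_nhds y hδ)).1
    (h.continuousOn y ⟨hy, mem_ball_self hδ⟩)

/-- A locally `K`-Lipschitz map on `S` stretches the length of a path in `S` at most by `K`. -/
lemma eVariationOn_comp_le_of_locally_lipschitz {E F : Type*} [PseudoMetricSpace E]
    [PseudoMetricSpace F] {S : Set E} {f : E → F} {K : NNReal}
    (hf : ∀ y ∈ S, ∃ δ > 0, LipschitzOnWith K f (S ∩ ball y δ)) {γ : ℝ → E}
    (hγ : ContinuousOn γ (Icc 0 1)) (hS : MapsTo γ (Icc 0 1) S) :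
    eVariationOn (f ∘ γ) (Icc 0 1) ≤ K * eVariationOn γ (Icc 0 1) := by
  choose! δ hδ0 hδ using hf
  have hγr : Continuous fun t : Icc (0:ℝ) 1 => γ t := hγ.domRestrict
  obtain ⟨t, ht0, htm, ⟨m, hm⟩, ht⟩ := exists_monotone_Icc_subset_open_cover_Icc zero_le_one
    (c := fun i : Icc (0:ℝ) 1 => (fun s : Icc (0:ℝ) 1 => γ s) ⁻¹' ball (γ i) (δ (γ i)))
    (fun i => isOpen_ball.preimage hγr)
    (fun s _ => mem_iUnion.2 ⟨s, mem_ball_self (hδ0 _ (hS s.2))⟩)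
  have hmono : Monotone fun k => (t k : ℝ) := fun i j hij => htm hij
  have h1 := eVariationOn.sum' (f ∘ γ) hmono (n := m)
  have h2 := eVariationOn.sum' γ hmono (n := m)
  rw [ht0, hm m le_rfl] at h1 h2
  rw [← h1, ← h2, Finset.mul_sum]
  refine Finset.sum_le_sum fun k _ => ?_
  obtain ⟨i, hi⟩ := ht k
  refine (hδ (γ i) (hS i.2)).comp_eVariationOn_le fun s hs => ?_
  have hs01 : s ∈ Icc (0:ℝ) 1 := ⟨(t k).2.1.trans hs.1, hs.2.trans (t (k + 1)).2.2⟩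
  exact ⟨hS hs01, hi (show (⟨s, hs01⟩ : Icc (0:ℝ) 1) ∈ Icc (t k) (t (k + 1)) from hs)⟩

/-- A locally `K`-Lipschitz map from `S` to `T` stretches intrinsic distances at most by `K`. -/
lemma intrinsicDist_le_of_locally_lipschitz {n : ℕ} {S T : Set (EuclideanSpace ℝ (Fin n))}
    {f : EuclideanSpace ℝ (Fin n) → EuclideanSpace ℝ (Fin n)} {K : NNReal} (hK : K ≠ 0)
    (hm : MapsTo f S T)
    (hf : ∀ y ∈ S, ∃ δ > 0, LipschitzOnWith K f (S ∩ ball y δ)) (a b : EuclideanSpace ℝ (Fin n)) :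
    intrinsicDist T (f a) (f b) ≤ K * intrinsicDist S a b := by
  rw [← ENNReal.div_le_iff' (by simpa using hK) coe_ne_top]
  refine le_iInf fun γ => le_iInf fun hγ => le_iInf fun h0 => le_iInf fun h1 => le_iInf fun hS => ?_
  rw [ENNReal.div_le_iff' (by simpa using hK) coe_ne_top]
  refine le_trans ?_ (eVariationOn_comp_le_of_locally_lipschitz hf hγ hS)
  have hfc := (continuousOn_of_locally_lipschitz hf).comp hγ hS
  exact iInf_le_of_le (f ∘ γ) <| iInf_le_of_le hfc <| iInf_le_of_le (by simp [h0]) <|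
    iInf_le_of_le (by simp [h1]) <| iInf_le_of_le (fun t ht => hm (hS t ht)) le_rfl

/-- The inverse of a local isometry of boundary curves is locally almost `1`-Lipschitz. -/
lemma IsBoundaryLocalIsometry.exists_lipschitzOnWith_inverse
    {U V : Set (EuclideanSpace ℝ (Fin 2))} {f g : EuclideanSpace ℝ (Fin 2) → EuclideanSpace ℝ (Fin 2)}
    (hf : IsBoundaryLocalIsometry U V f) (hU : IsOpen U) (hV : IsOpen V) (hUb : HasC1Boundary U)
    (hVb : HasC1Boundary V) (hg : InvOn g f (frontier U) (frontier V)) {K : NNReal} (hK : 1 < K)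
    {z : EuclideanSpace ℝ (Fin 2)} (hz : z ∈ frontier V) :
    ∃ δ > 0, LipschitzOnWith K g (frontier V ∩ ball z δ) := by
  obtain ⟨y, hy, rfl⟩ := hf.1.surjOn hz
  have hfc : ContinuousOn f (frontier U) := continuousOn_of_locally_lipschitz fun y hy =>
    hf.exists_lipschitzOnWith hU hUb one_lt_two hy
  obtain ⟨δ, hδ0, hδ⟩ := hf.exists_relDist_eq hU hUb hy
  obtain ⟨δ₁, hδ₁0, hδ₁⟩ := exists_relDist_le hV hVb hz hK
  obtain ⟨O, hO, hOim⟩ := exists_nhds_subset_image hUb hVb hfc hf.1.mapsTo hf.1.injOn hy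
    (ball_mem_nhds y hδ0)
  obtain ⟨δ₂, hδ₂0, hδ₂⟩ := Metric.mem_nhds_iff.1 hO
  refine ⟨min δ₁ δ₂, lt_min hδ₁0 hδ₂0, fun c hc d hd => ?_⟩
  have h1 : frontier V ∩ ball (f y) (min δ₁ δ₂) ⊆ frontier V ∩ ball (f y) δ₁ := by
    gcongr; exact min_le_left _ _
  have h2 : frontier V ∩ ball (f y) (min δ₁ δ₂) ⊆ frontier V ∩ O :=
    inter_subset_inter_right _ ((ball_subset_ball (min_le_right _ _)).trans hδ₂)
  have h3 := hδ₁ c (h1 hc) d (h1 hd)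
  obtain ⟨a, ha, rfl⟩ := hOim c (h2 hc)
  obtain ⟨b, hb, rfl⟩ := hOim d (h2 hd)
  rw [hg.1 ha.1, hg.1 hb.1]
  exact ((edist_le_relDist U a b).trans (hδ a ha b hb).le).trans h3

lemma le_of_forall_one_lt_le_coe_mul {x y : ℝ≥0∞} (h : ∀ K : NNReal, 1 < K → x ≤ K * y) :
    x ≤ y := by
  rcases eq_or_ne y ⊤ with rfl | hy
  · exact le_top
  have h1 : Tendsto (fun K : NNReal => (K : ℝ≥0∞) * y) (𝓝[>] 1) (𝓝 y) := by
    have : Continuous fun K : NNReal => (K : ℝ≥0∞) * y :=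
      (ENNReal.continuous_mul_const hy).comp ENNReal.continuous_coe
    simpa using (this.tendsto 1).mono_left nhdsWithin_le_nhds
  exact ge_of_tendsto h1 (eventually_mem_nhdsWithin.mono fun K hK => h K hK)

/-- a bijective local isometry in the relative metrics between the
boundaries of two plane domains with smooth boundaries is a global isometry of
the boundary curves in their intrinsic metrics. -/
theorem local_isometry_is_global_intrinsic_isometry
    (U V : Set (EuclideanSpace ℝ (Fin 2)))
    (hU : IsDomainSet U) (hV : IsDomainSet V)
    (hUb : HasC1Boundary U) (hVb : HasC1Boundary V)
    (f : EuclideanSpace ℝ (Fin 2) → EuclideanSpace ℝ (Fin 2))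
    (hf : IsBoundaryLocalIsometry U V f) :
    ∀ a ∈ frontier U, ∀ b ∈ frontier U,
      intrinsicDist (frontier U) a b = intrinsicDist (frontier V) (f a) (f b) := by
  intro a ha b hb
  have hg : InvOn (Function.invFunOn f (frontier U)) f (frontier U) (frontier V) :=
    hf.1.invOn_invFunOn
  have hgm : MapsTo (Function.invFunOn f (frontier U)) (frontier V) (frontier U) :=
    hf.1.surjOn.mapsTo_invFunOn
  apply le_antisymm
  · refine le_of_forall_one_lt_le_coe_mul fun K hK => ?_
    have := intrinsicDist_le_of_locally_lipschitz (zero_lt_one.trans hK).ne' hgm (fun z hz =>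
      hf.exists_lipschitzOnWith_inverse hU.1 hV.1 hUb hVb hg hK hz) (f a) (f b)
    rwa [hg.1 ha, hg.1 hb] at this
  · exact le_of_forall_one_lt_le_coe_mul fun K hK =>
      intrinsicDist_le_of_locally_lipschitz (zero_lt_one.trans hK).ne' hf.1.mapsTo
        (fun y hy => hf.exists_lipschitzOnWith hU.1 hUb hK hy) a b

end
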